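/- arXiv:math/0404141 — 2 statements merged into one kernel-verified Lean document; each statement's English description precedes it below -/
import Mathlib

section
/- Let F = ℚ(z_1,…,z_n,w_1,…,w_n) be the field of rational functions in 2n variables, with the symmetric group S_n acting diagonally (permuting the z_j's and w_j's simultaneously). Then the 2n bisymmetric power sums τ_{(1,0)},…,τ_{(n,0)}, τ_{(0,1)}, τ_{(1,1)},…,τ_{(n−1,1)} are algebraically independent over ℚ, and the fixed field F^{S_n} equals the subfield of F generated over ℚ by these 2n elements. -/
open MvPolynomial

/-- The bisymmetric power sum `τ_{(r,s)} = Σ_{j=1}^n z_j^r w_j^s` in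
`ℚ[z_1,…,z_n,w_1,…,w_n]`. -/
noncomputable def tau (n : ℕ) (r s : ℕ) : MvPolynomial (Fin n ⊕ Fin n) ℚ :=
  ∑ j : Fin n, X (Sum.inl j) ^ r * X (Sum.inr j) ^ s

/-- The field `F = ℚ(z_1,…,z_n,w_1,…,w_n)` of rational functions in `2n`
variables. -/
abbrev RatFuncField (n : ℕ) : Type :=
  FractionRing (MvPolynomial (Fin n ⊕ Fin n) ℚ)

/-- The diagonal action of a permutation `π ∈ S_n` on `ℚ(z_1,…,z_n,w_1,…,w_n)`,
permuting the `z_j`'s and the `w_j`'s simultaneously. -/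
noncomputable def diagPermAction (n : ℕ) (π : Equiv.Perm (Fin n)) :
    RatFuncField n ≃+* RatFuncField n :=
  IsFractionRing.ringEquivOfRingEquiv
    (MvPolynomial.renameEquiv ℚ (Equiv.sumCongr π π)).toRingEquiv

/-- The `2n` distinguished bisymmetric power sums, viewed in the field `F`:
the left copy of `Fin n` indexes `τ_{(1,0)},…,τ_{(n,0)}` and the right copy
indexes `τ_{(0,1)}, τ_{(1,1)},…,τ_{(n−1,1)}`. -/
noncomputable def tauGens (n : ℕ) : Fin n ⊕ Fin n → RatFuncField n :=
  fun i => Sum.elim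
    (fun k => algebraMap (MvPolynomial (Fin n ⊕ Fin n) ℚ) (RatFuncField n)
      (tau n (k.1 + 1) 0))
    (fun k => algebraMap (MvPolynomial (Fin n ⊕ Fin n) ℚ) (RatFuncField n)
      (tau n k.1 1)) i

section PowerSums

variable {k L : Type*} [Field k] [Field L] [Algebra k L] {n : ℕ}

theorem aeval_esymm_mem_of_sum_pow_mem [CharZero k] (K : IntermediateField k L) (z : Fin n → L)
    (h : ∀ i < n, ∑ j, z j ^ (i + 1) ∈ K) {m : ℕ} (hm : m ≤ n) :
    aeval z (esymm (Fin n) k m) ∈ K := by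
  induction m using Nat.strong_induction_on with
  | _ m ih =>
    rcases Nat.eq_zero_or_pos m with rfl | hpos
    · simp
    have key := congrArg (aeval z) (mul_esymm_eq_sum (Fin n) k m)
    have hmem : (m : L) * aeval z (esymm (Fin n) k m) ∈ K := by
      rw [map_mul, map_natCast] at key
      rw [key]
      simp only [map_mul, map_pow, map_neg, map_one, map_sum]
      refine mul_mem (pow_mem (neg_mem (one_mem K)) _) (sum_mem fun a ha => ?_)
      rw [Finset.mem_filter] at ha
      have hsum : a.1 + a.2 = m := Finset.HasAntidiagonal.mem_antidiagonal.mp ha.1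
      refine mul_mem (mul_mem (pow_mem (neg_mem (one_mem K)) _) (ih _ ha.2 (by omega))) ?_
      obtain ⟨i, hi⟩ : ∃ i, a.2 = i + 1 := ⟨a.2 - 1, by omega⟩
      simpa [psum, hi] using h i (by omega)
    have : CharZero L := charZero_of_injective_algebraMap (algebraMap k L).injective
    have hm0 : (m : L) ≠ 0 := Nat.cast_ne_zero.mpr hpos.ne'
    simpa [hm0] using mul_mem (inv_mem (natCast_mem K m)) hmem

theorem exists_map_eq_prod_X_sub_C_of_sum_pow_mem [CharZero k] (K : IntermediateField k L)
    (z : Fin n → L) (h : ∀ i < n, ∑ j, z j ^ (i + 1) ∈ K) :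
    ∃ p : Polynomial K,
      p.map (algebraMap K L) = ∏ j, (Polynomial.X - Polynomial.C (z j)) := by
  have hlift : (∏ j, (Polynomial.X - Polynomial.C (z j))) ∈ Polynomial.lifts (algebraMap K L) := by
    rw [Polynomial.lifts_iff_coeff_lifts]
    intro i
    by_cases hi : i ≤ n
    · have hcard : i ≤ Multiset.card (Finset.univ.val.map z) := by simpa using hi
      have := Multiset.prod_X_sub_C_coeff _ hcard
      rw [Multiset.map_map, ← aeval_esymm_eq_multiset_esymm (Fin n) k] at this
      exact ⟨⟨_, mul_mem (pow_mem (neg_mem (one_mem K)) _)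
        (aeval_esymm_mem_of_sum_pow_mem K z h (by simp))⟩, this.symm⟩
    · rw [Polynomial.coeff_eq_zero_of_natDegree_lt]
      · exact ⟨0, map_zero _⟩
      · rw [Polynomial.natDegree_finsetProd_X_sub_C_eq_card]
        simpa using hi
  exact (Polynomial.mem_lifts _).mp hlift

theorem eq_of_forall_sum_pow_mul_eq {z a b : Fin n → L} (hz : Function.Injective z)
    (h : ∀ i < n, ∑ j, z j ^ i * a j = ∑ j, z j ^ i * b j) : a = b := by
  rw [← sub_eq_zero]
  refine Matrix.eq_zero_of_forall_pow_sum_mul_pow_eq_zero hz fun i => ?_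
  simp only [Pi.sub_apply, sub_mul, Finset.sum_sub_distrib]
  rw [sub_eq_zero]
  simpa only [mul_comm] using h i i.2

theorem mem_of_forall_sum_pow_mul_mem (E : IntermediateField k L) {z w : Fin n → L}
    (hz : Function.Injective z) (hzE : ∀ j, z j ∈ E)
    (h : ∀ i < n, ∑ j, z j ^ i * w j ∈ E) (j : Fin n) : w j ∈ E := by
  let z' : Fin n → E := fun j => ⟨z j, hzE j⟩
  let t : Fin n → E := fun i => ⟨∑ j, z j ^ (i : ℕ) * w j, h i i.2⟩
  have hz' : Function.Injective z' := fun a b hab => hz (congrArg Subtype.val hab)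
  have hdet : IsUnit (Matrix.vandermonde z').transpose.det := by
    rw [Matrix.det_transpose]
    exact (Matrix.det_vandermonde_ne_zero_iff.mpr hz').isUnit
  let v := (Matrix.vandermonde z').transpose⁻¹.mulVec t
  have hv : (Matrix.vandermonde z').transpose.mulVec v = t := by
    simp [v, Matrix.mulVec_mulVec, Matrix.mul_nonsing_inv _ hdet]
  have hw : w = fun j => (v j : L) := by
    refine eq_of_forall_sum_pow_mul_eq hz fun i hi => ?_
    have := congrArg Subtype.val (congrFun hv ⟨i, hi⟩)
    simpa [Matrix.mulVec, dotProduct, Matrix.vandermonde, z', t] using this.symm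
  rw [hw]
  exact (v j).2

variable [CharZero k] {K : IntermediateField k L} {z w : Fin n → L}

theorem exists_separable_isSplittingField (hz : Function.Injective z)
    (htop : IntermediateField.adjoin k (Set.range (Sum.elim z w)) = ⊤)
    (hpow : ∀ i < n, ∑ j, z j ^ (i + 1) ∈ K) (hmix : ∀ i < n, ∑ j, z j ^ i * w j ∈ K) :
    ∃ p : Polynomial K, p.Separable ∧ p.IsSplittingField K L := by
  obtain ⟨p, hp⟩ := exists_map_eq_prod_X_sub_C_of_sum_pow_mem K z hpow
  have hp0 : p ≠ 0 := by
    rintro rfl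
    rw [Polynomial.map_zero] at hp
    exact (Polynomial.monic_prod_X_sub_C z Finset.univ).ne_zero hp.symm
  refine ⟨p, ?_, ?_⟩
  · rw [← Polynomial.separable_map (algebraMap K L), hp]
    exact Polynomial.separable_prod_X_sub_C_iff.mpr hz
  · rw [isSplittingField_iff_intermediateField]
    constructor
    · rw [hp]
      exact Polynomial.Splits.prod fun j _ => Polynomial.Splits.X_sub_C _
    · set E := IntermediateField.adjoin K (p.rootSet L)
      have hzE : ∀ j, z j ∈ E.restrictScalars k := fun j =>
        IntermediateField.subset_adjoin K _ <| by
          rw [Polynomial.mem_rootSet_of_ne hp0, Polynomial.aeval_def, Polynomial.eval₂_eq_eval_map,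
            hp, Polynomial.eval_prod]
          exact Finset.prod_eq_zero (Finset.mem_univ j) (by simp)
      have hwE := mem_of_forall_sum_pow_mul_mem (E.restrictScalars k) hz hzE fun i hi =>
        E.algebraMap_mem ⟨_, hmix i hi⟩
      rw [← IntermediateField.restrictScalars_eq_top_iff (K := k), eq_top_iff, ← htop,
        IntermediateField.adjoin_le_iff]
      rintro _ ⟨j | j, rfl⟩
      exacts [hzE j, hwE j]

theorem exists_perm_forall_apply_eq (hz : Function.Injective z)
    (hpow : ∀ i < n, ∑ j, z j ^ (i + 1) ∈ K) (hmix : ∀ i < n, ∑ j, z j ^ i * w j ∈ K)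
    (σ : L ≃ₐ[K] L) :
    ∃ π : Equiv.Perm (Fin n), ∀ j, σ (z j) = z (π j) ∧ σ (w j) = w (π j) := by
  obtain ⟨p, hp⟩ := exists_map_eq_prod_X_sub_C_of_sum_pow_mem K z hpow
  have hroot : ∀ j, ∃ i, σ (z j) = z i := fun j => by
    have h1 : Polynomial.aeval (z j) p = 0 := by
      rw [Polynomial.aeval_def, Polynomial.eval₂_eq_eval_map, hp, Polynomial.eval_prod]
      exact Finset.prod_eq_zero (Finset.mem_univ j) (by simp)
    have h2 : Polynomial.aeval (σ (z j)) p = 0 := by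
      rw [Polynomial.aeval_algHom_apply, h1, map_zero]
    rw [Polynomial.aeval_def, Polynomial.eval₂_eq_eval_map, hp, Polynomial.eval_prod,
      Finset.prod_eq_zero_iff] at h2
    obtain ⟨i, -, hi⟩ := h2
    exact ⟨i, by simpa [sub_eq_zero] using hi⟩
  choose f hf using hroot
  have hinj : Function.Injective f := fun a b hab =>
    hz (σ.injective (by rw [hf, hf, hab]))
  let π := Equiv.ofBijective f (Finite.injective_iff_bijective.mp hinj)
  have hπ : ∀ j, σ (z j) = z (π j) := hf
  have hw : (fun j => σ (w j)) = fun j => w (π j) := by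
    refine eq_of_forall_sum_pow_mul_eq (hz.comp π.injective) fun i hi => ?_
    calc ∑ j, z (π j) ^ i * σ (w j) = σ (∑ j, z j ^ i * w j) := by simp [hπ]
      _ = ∑ j, z j ^ i * w j := σ.commutes ⟨_, hmix i hi⟩
      _ = ∑ j, z (π j) ^ i * w (π j) := (Equiv.sum_comp π fun j => z j ^ i * w j).symm
  exact ⟨π, fun j => ⟨hπ j, congrFun hw j⟩⟩

end PowerSums

section RatFuncField

variable {n : ℕ}

/-- The variables of `MvPolynomial (Fin n ⊕ Fin n) ℚ`, viewed in the field `F`. -/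
noncomputable def ratFuncVar (n : ℕ) (i : Fin n ⊕ Fin n) : RatFuncField n :=
  algebraMap (MvPolynomial (Fin n ⊕ Fin n) ℚ) (RatFuncField n) (X i)

theorem ratFuncVar_injective : Function.Injective (ratFuncVar n) :=
  (IsFractionRing.injective (MvPolynomial (Fin n ⊕ Fin n) ℚ) (RatFuncField n)).comp
    (X_injective (R := ℚ))

theorem algebraMap_tau (r s : ℕ) :
    algebraMap (MvPolynomial (Fin n ⊕ Fin n) ℚ) (RatFuncField n) (tau n r s) =
      ∑ j, ratFuncVar n (Sum.inl j) ^ r * ratFuncVar n (Sum.inr j) ^ s := by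
  simp [tau, ratFuncVar]

theorem diagPermAction_ratFuncVar (π : Equiv.Perm (Fin n)) (i : Fin n ⊕ Fin n) :
    diagPermAction n π (ratFuncVar n i) = ratFuncVar n (Equiv.sumCongr π π i) := by
  rw [diagPermAction, ratFuncVar, IsFractionRing.ringEquivOfRingEquiv_algebraMap]
  simp [ratFuncVar]

theorem ringHom_ext_ratFuncVar {f g : RatFuncField n →+* RatFuncField n}
    (h : ∀ i, f (ratFuncVar n i) = g (ratFuncVar n i)) : f = g := by
  refine IsLocalization.ringHom_ext
    (nonZeroDivisors (MvPolynomial (Fin n ⊕ Fin n) ℚ)) (MvPolynomial.ringHom_ext' ?_ h)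
  exact Subsingleton.elim _ _

theorem adjoin_range_ratFuncVar :
    IntermediateField.adjoin ℚ (Set.range (ratFuncVar n)) = ⊤ := by
  rw [eq_top_iff]
  intro x _
  have hpoly : ∀ p : MvPolynomial (Fin n ⊕ Fin n) ℚ,
      algebraMap _ (RatFuncField n) p ∈
        IntermediateField.adjoin ℚ (Set.range (ratFuncVar n)) := fun p => by
    induction p using MvPolynomial.induction_on with
    | C a =>
      rw [← algebraMap_eq, ← IsScalarTower.algebraMap_apply ℚ _ (RatFuncField n)]
      exact IntermediateField.algebraMap_mem _ a
    | add p q hp hq =>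
      rw [map_add]
      exact add_mem hp hq
    | mul_X p i hp =>
      rw [map_mul]
      exact mul_mem hp (IntermediateField.subset_adjoin _ _ ⟨i, rfl⟩)
  obtain ⟨a, b, -, rfl⟩ := IsFractionRing.div_surjective (A := MvPolynomial (Fin n ⊕ Fin n) ℚ) x
  exact div_mem (hpoly a) (hpoly b)

theorem sum_pow_mem_adjoin_tauGens (i : ℕ) (hi : i < n) :
    ∑ j, ratFuncVar n (Sum.inl j) ^ (i + 1) ∈
      IntermediateField.adjoin ℚ (Set.range (tauGens n)) :=
  IntermediateField.subset_adjoin _ _ ⟨Sum.inl ⟨i, hi⟩, by simp [tauGens, algebraMap_tau]⟩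

theorem sum_pow_mul_mem_adjoin_tauGens (i : ℕ) (hi : i < n) :
    ∑ j, ratFuncVar n (Sum.inl j) ^ i * ratFuncVar n (Sum.inr j) ∈
      IntermediateField.adjoin ℚ (Set.range (tauGens n)) :=
  IntermediateField.subset_adjoin _ _ ⟨Sum.inr ⟨i, hi⟩, by simp [tauGens, algebraMap_tau]⟩

theorem diagPermAction_tauGens (π : Equiv.Perm (Fin n)) (i : Fin n ⊕ Fin n) :
    diagPermAction n π (tauGens n i) = tauGens n i := by
  have key : ∀ r s, diagPermAction n π (algebraMap _ (RatFuncField n) (tau n r s)) =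
      algebraMap _ (RatFuncField n) (tau n r s) := fun r s => by
    simp only [algebraMap_tau, map_sum, map_mul, map_pow, diagPermAction_ratFuncVar]
    exact Equiv.sum_comp π fun j => ratFuncVar n (Sum.inl j) ^ r * ratFuncVar n (Sum.inr j) ^ s
  rcases i with i | i <;> exact key _ _

theorem exists_separable_isSplittingField_adjoin_tauGens :
    ∃ p : Polynomial (IntermediateField.adjoin ℚ (Set.range (tauGens n))), p.Separable ∧
      p.IsSplittingField (IntermediateField.adjoin ℚ (Set.range (tauGens n)))
        (RatFuncField n) := by
  refine exists_separable_isSplittingField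
    (z := fun j => ratFuncVar n (Sum.inl j)) (w := fun j => ratFuncVar n (Sum.inr j))
    (ratFuncVar_injective.comp Sum.inl_injective) ?_
    sum_pow_mem_adjoin_tauGens sum_pow_mul_mem_adjoin_tauGens
  rw [← adjoin_range_ratFuncVar]
  congr 2
  exact Sum.elim_comp_inl_inr (ratFuncVar n)

open scoped IntermediateField.algebraAdjoinAdjoin in
theorem algebraicIndependent_tauGens : AlgebraicIndependent ℚ (tauGens n) := by
  obtain ⟨p, -, hsplit⟩ := exists_separable_isSplittingField_adjoin_tauGens (n := n)
  have hfin := Polynomial.IsSplittingField.finiteDimensional (RatFuncField n) p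
  have halg : Algebra.IsAlgebraic (Algebra.adjoin ℚ (Set.range (tauGens n))) (RatFuncField n) :=
    (IsFractionRing.comap_isAlgebraic_iff
      (K := IntermediateField.adjoin ℚ (Set.range (tauGens n)))).mpr inferInstance
  have hvar : AlgebraicIndependent ℚ (ratFuncVar n) :=
    (algebraicIndependent_X (Fin n ⊕ Fin n) ℚ).map'
      (f := IsScalarTower.toAlgHom ℚ (MvPolynomial (Fin n ⊕ Fin n) ℚ) (RatFuncField n))
      (IsFractionRing.injective _ _)
  exact (Algebra.IsAlgebraic.isTranscendenceBasis_of_le_trdeg_of_finite ℚ (tauGens n) hvar.cardinalMk_le_trdeg).1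

theorem mem_adjoin_tauGens_of_forall_diagPermAction_eq {x : RatFuncField n}
    (hx : ∀ π : Equiv.Perm (Fin n), diagPermAction n π x = x) :
    x ∈ IntermediateField.adjoin ℚ (Set.range (tauGens n)) := by
  obtain ⟨p, hsep, hsplit⟩ := exists_separable_isSplittingField_adjoin_tauGens (n := n)
  have hfin := Polynomial.IsSplittingField.finiteDimensional (RatFuncField n) p
  have hgal := IsGalois.of_separable_splitting_field (E := RatFuncField n) hsep
  obtain ⟨y, rfl⟩ := (IsGalois.mem_range_algebraMap_iff_fixed x).mpr fun σ => by
    obtain ⟨π, hπ⟩ := exists_perm_forall_apply_eq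
      (z := fun j => ratFuncVar n (Sum.inl j)) (w := fun j => ratFuncVar n (Sum.inr j))
      (ratFuncVar_injective.comp Sum.inl_injective)
      sum_pow_mem_adjoin_tauGens sum_pow_mul_mem_adjoin_tauGens σ
    have hσ : (σ : RatFuncField n →+* RatFuncField n) = diagPermAction n π :=
      ringHom_ext_ratFuncVar fun i => by
        rcases i with j | j
        · exact (hπ j).1.trans (diagPermAction_ratFuncVar π (Sum.inl j)).symm
        · exact (hπ j).2.trans (diagPermAction_ratFuncVar π (Sum.inr j)).symm
    exact (DFunLike.congr_fun hσ x).trans (hx π)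
  exact y.2

theorem diagPermAction_eq_of_mem_adjoin_tauGens {x : RatFuncField n}
    (hx : x ∈ IntermediateField.adjoin ℚ (Set.range (tauGens n))) (π : Equiv.Perm (Fin n)) :
    diagPermAction n π x = x := by
  induction hx using IntermediateField.adjoin_induction with
  | mem x hx =>
    obtain ⟨i, rfl⟩ := hx
    exact diagPermAction_tauGens π i
  | algebraMap q => simp
  | add x y _ _ hx hy => rw [map_add, hx, hy]
  | inv x _ hx => rw [map_inv₀, hx]
  | mul x y _ _ hx hy => rw [map_mul, hx, hy]

end RatFuncField

/-- The bisymmetric power sums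
`τ_{(1,0)},…,τ_{(n,0)}, τ_{(0,1)}, τ_{(1,1)},…,τ_{(n−1,1)}` are algebraically
independent over `ℚ`, and the fixed field `F^{S_n}` of the diagonal
`S_n`-action on `F = ℚ(z_1,…,z_n,w_1,…,w_n)` is the subfield generated over
`ℚ` by these `2n` elements. -/
theorem fixedField_eq_adjoin_tau (n : ℕ) (hn : 1 ≤ n) :
    AlgebraicIndependent ℚ (tauGens n) ∧
    {x : RatFuncField n | ∀ π : Equiv.Perm (Fin n), diagPermAction n π x = x} =
      (IntermediateField.adjoin ℚ (Set.range (tauGens n)) :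
        IntermediateField ℚ (RatFuncField n)) := by
  refine ⟨algebraicIndependent_tauGens, Set.ext fun x => ⟨fun hx => ?_, fun hx => ?_⟩⟩
  · exact mem_adjoin_tauGens_of_forall_diagPermAction_eq hx
  · exact diagPermAction_eq_of_mem_adjoin_tauGens hx
end

section
/- In ℚ[z_1,…,z_n,w_1,…,w_n], the ring of bisymmetric functions (the subring of invariants under the diagonal S_n-action) is generated as a ℚ-algebra by the bisymmetric power sums τ_{(r,s)} with r,s ≥ 0 and 1 ≤ r+s ≤ n. -/
open MvPolynomial

/-- The subring of invariants of the diagonal `S_n`-action on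
`ℚ[z_1,…,z_n,w_1,…,w_n]` (the ring of bisymmetric functions). -/
noncomputable def bisymmetricFunctions (n : ℕ) :
    Subalgebra ℚ (MvPolynomial (Fin n ⊕ Fin n) ℚ) :=
  ⨅ π : Equiv.Perm (Fin n),
    AlgHom.equalizer
      (rename (Sum.map π π) : MvPolynomial (Fin n ⊕ Fin n) ℚ →ₐ[ℚ]
        MvPolynomial (Fin n ⊕ Fin n) ℚ)
      (AlgHom.id ℚ (MvPolynomial (Fin n ⊕ Fin n) ℚ))

/-- A `ℚ`-subalgebra containing the first `|σ|` power sums contains all elementary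
symmetric polynomials. -/
theorem esymm_mem_of_psum_mem {σ : Type*} [Fintype σ]
    (S : Subalgebra ℚ (MvPolynomial σ ℚ))
    (hS : ∀ k, 1 ≤ k → k ≤ Fintype.card σ → psum σ ℚ k ∈ S) (k : ℕ) :
    esymm σ ℚ k ∈ S := by
  induction k using Nat.strong_induction_on with
  | _ k ih =>
    rcases Nat.eq_zero_or_pos k with rfl | hk
    · simp
    by_cases hkn : k ≤ Fintype.card σ
    · have hmem : (k : MvPolynomial σ ℚ) * esymm σ ℚ k ∈ S := by
        rw [mul_esymm_eq_sum]
        refine S.mul_mem (S.pow_mem (S.neg_mem S.one_mem) _) (S.sum_mem fun a ha => ?_)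
        rw [Finset.mem_filter] at ha
        have hadd := Finset.HasAntidiagonal.mem_antidiagonal.1 ha.1
        exact S.mul_mem (S.mul_mem (S.pow_mem (S.neg_mem S.one_mem) _) (ih _ ha.2))
          (hS _ (by lia) (by lia))
      have hk0 : (k : ℚ) ≠ 0 := by exact_mod_cast hk.ne'
      rw [← nsmul_eq_mul, ← Nat.cast_smul_eq_nsmul ℚ] at hmem
      simpa [smul_smul, hk0] using S.smul_mem hmem (k : ℚ)⁻¹
    · rw [esymm, Finset.powersetCard_eq_empty.2 (by simpa using hkn), Finset.sum_empty]
      exact S.zero_mem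

/-- A `ℚ`-subalgebra containing the first `|σ|` power sums contains all power
sums. -/
theorem psum_mem_of_psum_mem {σ : Type*} [Fintype σ]
    (S : Subalgebra ℚ (MvPolynomial σ ℚ))
    (hS : ∀ k, 1 ≤ k → k ≤ Fintype.card σ → psum σ ℚ k ∈ S) (k : ℕ) :
    psum σ ℚ k ∈ S := by
  induction k using Nat.strong_induction_on with
  | _ k ih =>
    rcases Nat.eq_zero_or_pos k with rfl | hk
    · rw [psum_zero]
      exact natCast_mem S _
    rw [psum_eq_mul_esymm_sub_sum σ ℚ k hk]
    have hneg (m : ℕ) : (-1 : MvPolynomial σ ℚ) ^ m ∈ S := S.pow_mem (S.neg_mem S.one_mem) m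
    refine S.sub_mem (S.mul_mem (S.mul_mem (hneg _) (natCast_mem S k))
      (esymm_mem_of_psum_mem S hS k)) (S.sum_mem fun a ha => ?_)
    rw [Finset.mem_filter, Set.mem_Ioo] at ha
    have hadd := Finset.HasAntidiagonal.mem_antidiagonal.1 ha.1
    exact S.mul_mem (S.mul_mem (hneg _) (esymm_mem_of_psum_mem S hS _)) (ih _ (by lia))

/-- If all values of a polynomial function with vector coefficients lie in a subspace, then so do
its coefficients. -/
theorem Submodule.coeff_mem_of_forall_sum_pow_smul_mem {K V : Type*} [Field K] [Infinite K]
    [AddCommGroup V] [Module K V] (W : Submodule K V) (m : ℕ) (v : ℕ → V)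
    (h : ∀ c : K, ∑ i ∈ Finset.range m, c ^ i • v i ∈ W) {i : ℕ} (hi : i < m) : v i ∈ W := by
  rw [← Subspace.forall_mem_dualAnnihilator_apply_eq_zero_iff W]
  intro φ hφ
  have hpoly : ∑ j ∈ Finset.range m, Polynomial.monomial j (φ (v j)) = 0 := by
    refine Polynomial.funext fun c => ?_
    have := (Submodule.mem_dualAnnihilator φ).1 hφ _ (h c)
    simpa [Polynomial.eval_finsetSum, mul_comm] using this
  simpa [Polynomial.finsetSum_coeff, Polynomial.coeff_monomial, hi] using
    congrArg (fun p => p.coeff i) hpoly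

/-- If `S` contains the sums `∑ j, g j` for all `g` in a multiplicatively closed set `H`, then it
contains all the sums `∑ σ, ∏ i, h i (σ i)` over injections `σ`, where each `h i` is in `H`. -/
theorem Subalgebra.sum_embedding_prod_mem {R A ι : Type*} [CommRing R] [CommRing A] [Algebra R A]
    [Fintype ι] [DecidableEq ι] (S : Subalgebra R A) (H : Set (ι → A))
    (hmul : ∀ f ∈ H, ∀ g ∈ H, f * g ∈ H) (hsum : ∀ g ∈ H, ∑ j, g j ∈ S) (k : ℕ)
    (h : Fin k → ι → A) (hh : ∀ i, h i ∈ H) :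
    ∑ e : Fin k ↪ ι, ∏ i, h i (e i) ∈ S := by
  induction k with
  | zero => exact S.sum_mem fun e _ => by simp
  | succ k ih =>
    have hcompl (e : Fin k ↪ ι) : ∑ x : {x // x ∉ Set.range e}, h 0 x =
        ∑ x, h 0 x - ∑ s, h 0 (e s) := by
      rw [eq_sub_iff_add_eq', ← Fintype.sum_subtype_add_sum_subtype (· ∈ Set.range e) (h 0)]
      congr 1
      convert Fintype.sum_equiv (Equiv.ofInjective e e.injective) (fun s => h 0 (e s))
        (fun x => h 0 x) fun _ => rfl
    have hupdate (e : Fin k ↪ ι) (s : Fin k) :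
        ∏ i, Function.update (fun i => h i.succ) s (h s.succ * h 0) i (e i) =
          h 0 (e s) * ∏ i, h (Fin.succ i) (e i) := by
      rw [← Finset.mul_prod_erase _ _ (Finset.mem_univ s),
        ← Finset.mul_prod_erase _ (fun i => h (Fin.succ i) (e i)) (Finset.mem_univ s)]
      rw [Finset.prod_congr rfl (g := fun i => h (Fin.succ i) (e i))]
      · simp only [Function.update_self, Pi.mul_apply]
        ring
      · intro i hi
        rw [Function.update_of_ne (Finset.ne_of_mem_erase hi)]
    have hrec : ∑ e : Fin (k + 1) ↪ ι, ∏ i, h i (e i) =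
        (∑ x, h 0 x) * ∑ e : Fin k ↪ ι, ∏ i, h (Fin.succ i) (e i) -
          ∑ s, ∑ e : Fin k ↪ ι,
            ∏ i, Function.update (fun i => h i.succ) s (h s.succ * h 0) i (e i) := by
      rw [← (Equiv.embeddingFinSucc k ι).symm.sum_comp, Fintype.sum_sigma, Finset.sum_comm,
        Finset.mul_sum, ← Finset.sum_sub_distrib]
      refine Finset.sum_congr rfl fun e _ => ?_
      simp only [Equiv.coe_embeddingFinSucc_symm, Fin.prod_univ_succ, Fin.cons_zero,
        Fin.cons_succ, hupdate]
      rw [← Finset.sum_mul, ← Finset.sum_mul, ← sub_mul, hcompl]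
    rw [hrec]
    refine S.sub_mem (S.mul_mem (hsum _ (hh 0)) (ih _ fun i => hh _))
      (S.sum_mem fun s _ => ih _ fun i => ?_)
    rcases eq_or_ne i s with rfl | his
    · rw [Function.update_self]
      exact hmul _ (hh _) _ (hh _)
    · rw [Function.update_of_ne his]
      exact hh _

/-- The power sums of the linear forms `z_j + c w_j` expand into bisymmetric power sums. -/
theorem aeval_psum_add_smul (n k : ℕ) (c : ℚ) :
    aeval (fun j : Fin n => (X (Sum.inl j) + c • X (Sum.inr j) : MvPolynomial (Fin n ⊕ Fin n) ℚ))
      (psum (Fin n) ℚ k) =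
      ∑ i ∈ Finset.range (k + 1), c ^ i • ((k.choose i : ℚ) • tau n (k - i) i) := by
  simp only [psum, map_sum, map_pow, aeval_X, tau, Finset.smul_sum]
  rw [Finset.sum_comm]
  refine Finset.sum_congr rfl fun j _ => ?_
  rw [add_comm, add_pow]
  refine Finset.sum_congr rfl fun i _ => ?_
  simp only [smul_eq_C_mul, map_natCast, map_pow]
  ring

/-- A subalgebra containing the bisymmetric power sums of degree between `1` and `n` contains all
bisymmetric power sums. -/
theorem tau_mem_of_tau_mem {n : ℕ} (S : Subalgebra ℚ (MvPolynomial (Fin n ⊕ Fin n) ℚ))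
    (hS : ∀ r s, 1 ≤ r + s → r + s ≤ n → tau n r s ∈ S) (r s : ℕ) : tau n r s ∈ S := by
  have hpsum (c : ℚ) (k : ℕ) : ∑ i ∈ Finset.range (k + 1),
      c ^ i • ((k.choose i : ℚ) • tau n (k - i) i) ∈ S := by
    rw [← aeval_psum_add_smul]
    refine psum_mem_of_psum_mem (S.comap (aeval _)) (fun m hm hmn => ?_) k
    rw [Subalgebra.mem_comap, aeval_psum_add_smul]
    refine S.sum_mem fun i hi => S.smul_mem (S.smul_mem (hS _ _ ?_ ?_) _) _
    all_goals simp only [Finset.mem_range, Fintype.card_fin] at hi hmn; lia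
  have hmem := Submodule.coeff_mem_of_forall_sum_pow_smul_mem S.toSubmodule (r + s + 1) _
    (fun c => hpsum c (r + s)) (i := s) (by lia)
  have hchoose : ((r + s).choose s : ℚ) ≠ 0 := by
    exact_mod_cast (Nat.choose_pos (Nat.le_add_left s r)).ne'
  simpa [smul_smul, hchoose] using S.smul_mem hmem ((r + s).choose s : ℚ)⁻¹

/-- A subalgebra containing all bisymmetric power sums contains all symmetrizations. -/
theorem sum_rename_mem_of_tau_mem {n : ℕ} (S : Subalgebra ℚ (MvPolynomial (Fin n ⊕ Fin n) ℚ))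
    (hS : ∀ r s, tau n r s ∈ S) (p : MvPolynomial (Fin n ⊕ Fin n) ℚ) :
    ∑ π : Equiv.Perm (Fin n), rename (Sum.map π π) p ∈ S := by
  induction p using MvPolynomial.induction_on' with
  | add p q hp hq =>
    simp only [map_add, Finset.sum_add_distrib]
    exact S.add_mem hp hq
  | monomial d a =>
    have hmem := S.sum_embedding_prod_mem
      (Set.range fun t : ℕ × ℕ => fun j : Fin n =>
        (X (Sum.inl j) ^ t.1 * X (Sum.inr j) ^ t.2 : MvPolynomial (Fin n ⊕ Fin n) ℚ))
      (by
        rintro _ ⟨t, rfl⟩ _ ⟨u, rfl⟩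
        refine ⟨t + u, funext fun j => ?_⟩
        simp only [Prod.fst_add, Prod.snd_add, Pi.mul_apply]
        ring)
      (by
        rintro _ ⟨t, rfl⟩
        exact hS t.1 t.2) n
      (fun i j => X (Sum.inl j) ^ d (Sum.inl i) * X (Sum.inr j) ^ d (Sum.inr i))
      (fun i => ⟨(d (Sum.inl i), d (Sum.inr i)), rfl⟩)
    rw [← (Equiv.embeddingEquivOfFinite (Fin n)).symm.sum_comp] at hmem
    convert S.smul_mem hmem a using 1
    rw [Finset.smul_sum]
    refine Finset.sum_congr rfl fun π _ => ?_
    rw [monomial_eq, Finsupp.prod_fintype _ _ (by simp), Fintype.prod_sum_type]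
    simp [Finset.prod_mul_distrib, smul_eq_C_mul, Equiv.embeddingEquivOfFinite]

theorem mem_bisymmetricFunctions {n : ℕ} {p : MvPolynomial (Fin n ⊕ Fin n) ℚ} :
    p ∈ bisymmetricFunctions n ↔
      ∀ π : Equiv.Perm (Fin n), rename (Sum.map π π) p = p := by
  simp [bisymmetricFunctions, Algebra.mem_iInf, AlgHom.mem_equalizer]

theorem tau_mem_bisymmetricFunctions (n r s : ℕ) : tau n r s ∈ bisymmetricFunctions n := by
  rw [mem_bisymmetricFunctions]
  intro π
  simpa [tau] using
    Equiv.sum_comp π fun j => (X (Sum.inl j) ^ r * X (Sum.inr j) ^ s : MvPolynomial (Fin n ⊕ Fin n) ℚ)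

/-- The ring of bisymmetric functions is generated, as a `ℚ`-algebra, by the
bisymmetric power sums `τ_{(r,s)}` with `1 ≤ r + s ≤ n`. -/
theorem bisymmetric_eq_adjoin_tau (n : ℕ) (hn : 1 ≤ n) :
    bisymmetricFunctions n =
      Algebra.adjoin ℚ
        {p : MvPolynomial (Fin n ⊕ Fin n) ℚ |
          ∃ r s : ℕ, 1 ≤ r + s ∧ r + s ≤ n ∧ p = tau n r s} := by
  refine le_antisymm (fun p hp => ?_) (Algebra.adjoin_le ?_)
  · have hmem := sum_rename_mem_of_tau_mem _ (tau_mem_of_tau_mem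
      (Algebra.adjoin ℚ {p : MvPolynomial (Fin n ⊕ Fin n) ℚ |
        ∃ r s : ℕ, 1 ≤ r + s ∧ r + s ≤ n ∧ p = tau n r s})
      fun r s h1 h2 => Algebra.subset_adjoin ⟨r, s, h1, h2, rfl⟩) p
    have hfact : (n.factorial : ℚ) ≠ 0 := by exact_mod_cast n.factorial_ne_zero
    rw [Finset.sum_congr rfl fun π _ => mem_bisymmetricFunctions.1 hp π, Finset.sum_const,
      Finset.card_univ, Fintype.card_perm, Fintype.card_fin,
      ← Nat.cast_smul_eq_nsmul ℚ] at hmem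
    simpa only [smul_smul, inv_mul_cancel₀ hfact, one_smul] using
      Subalgebra.smul_mem _ hmem (n.factorial : ℚ)⁻¹
  · rintro _ ⟨r, s, -, -, rfl⟩
    exact tau_mem_bisymmetricFunctions n r s
end
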